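/- A finite graph is a unit interval graph if and only if it contains no induced claw, tent S_3, net, or hole. -/

import Mathlib

/-- A unit interval graph: vertices can be mapped to reals so that two distinct
vertices are adjacent iff their images are within distance 1. -/
def SimpleGraph.IsUnitIntervalGraph {V : Type*} (G : SimpleGraph V) : Prop :=
  ∃ f : V → ℝ, ∀ u v : V, u ≠ v → (G.Adj u v ↔ |f u - f v| ≤ 1)

/-- `f : ZMod n → V` describes a hole (induced cycle of length `n ≥ 4`) of `G`. -/
def SimpleGraph.IsHoleOn {V : Type*} (G : SimpleGraph V) (n : ℕ) (f : ZMod n → V) : Prop :=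
  4 ≤ n ∧ Function.Injective f ∧
    ∀ i j : ZMod n, (G.Adj (f i) (f j) ↔ (i = j + 1 ∨ j = i + 1))

def SimpleGraph.HasHole {V : Type*} (G : SimpleGraph V) : Prop :=
  ∃ (n : ℕ) (f : ZMod n → V), G.IsHoleOn n f

/-- A graph is chordal if it has no hole. -/
def SimpleGraph.Chordal {V : Type*} (G : SimpleGraph V) : Prop := ¬ G.HasHole

/-- `G` contains an induced copy of `H`. -/
def SimpleGraph.HasInducedCopy {V W : Type*} (G : SimpleGraph V) (H : SimpleGraph W) : Prop :=
  ∃ f : W → V, Function.Injective f ∧ ∀ a b : W, G.Adj (f a) (f b) ↔ H.Adj a b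

/-- The claw `K_{1,3}`, centered at vertex `0`. -/
def clawGraph : SimpleGraph (Fin 4) := SimpleGraph.fromRel (fun a _ => a = 0)

/-- The tent `S_3`: triangle on `0,1,2`; vertex `i+3` adjacent to `{0,1,2} \ {i}`. -/
def tentGraph : SimpleGraph (Fin 6) := SimpleGraph.fromRel (fun a b =>
  (a.val < 3 ∧ b.val < 3) ∨ (a.val < 3 ∧ 3 ≤ b.val ∧ b.val ≠ a.val + 3))

/-- The net: triangle on `0,1,2`; pendant vertex `i+3` adjacent exactly to `i`. -/
def netGraph : SimpleGraph (Fin 6) := SimpleGraph.fromRel (fun a b =>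
  (a.val < 3 ∧ b.val < 3) ∨ (a.val < 3 ∧ b.val = a.val + 3))

/-- The cycle `C_n` on `ZMod n`. -/
def cycleG (n : ℕ) : SimpleGraph (ZMod n) := SimpleGraph.fromRel (fun a b => a = b + 1)

/-- The wheel `W_n`: a cycle `C_n` plus a hub (`none`) adjacent to all cycle vertices. -/
def wheelG (n : ℕ) : SimpleGraph (Option (ZMod n)) := SimpleGraph.fromRel (fun a b =>
  a = none ∨ ∃ i j : ZMod n, a = some i ∧ b = some j ∧ i = j + 1)

/-- `C*_n`: a cycle `C_n` plus an isolated vertex (`none`). -/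
def cycleStarG (n : ℕ) : SimpleGraph (Option (ZMod n)) := SimpleGraph.fromRel (fun a b =>
  ∃ i j : ZMod n, a = some i ∧ b = some j ∧ i = j + 1)

/-- Raw data of a family of closed arcs on the circle `ℝ/Lℤ`: each vertex `v` gets the
arc traversed clockwise from (the image of) `src v` to `src v + len v`. -/
structure PreArcModel (V : Type*) where
  L : ℝ
  L_pos : 0 < L
  src : V → ℝ
  len : V → ℝ
  len_pos : ∀ v, 0 < len v
  len_lt : ∀ v, len v < L

namespace PreArcModel

variable {V : Type*}

/-- The counterclockwise endpoint of the arc of `v`. -/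
noncomputable def ccp (A : PreArcModel V) (v : V) : AddCircle A.L := (A.src v : ℝ)

/-- The clockwise endpoint of the arc of `v`. -/
noncomputable def cp (A : PreArcModel V) (v : V) : AddCircle A.L :=
  ((A.src v + A.len v : ℝ) : AddCircle A.L)

/-- The closed arc assigned to `v`, as a subset of the circle. -/
noncomputable def arc (A : PreArcModel V) (v : V) : Set (AddCircle A.L) :=
  (fun x : ℝ => (x : AddCircle A.L)) '' Set.Icc (A.src v) (A.src v + A.len v)

/-- All endpoints of all arcs are pairwise distinct. -/
def EndpointsDistinct (A : PreArcModel V) : Prop :=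
  Function.Injective (fun p : V × Bool => if p.2 then A.cp p.1 else A.ccp p.1)

/-- `A` is an arc model of the graph `G`: endpoints are pairwise distinct and two
distinct vertices are adjacent iff their arcs intersect. -/
def IsModelOf (A : PreArcModel V) (G : SimpleGraph V) : Prop :=
  A.EndpointsDistinct ∧ ∀ u v : V, u ≠ v → (G.Adj u v ↔ (A.arc u ∩ A.arc v).Nonempty)

/-- No arc is properly contained in another arc. -/
def Proper (A : PreArcModel V) : Prop := ∀ u v : V, ¬ A.arc u ⊂ A.arc v

/-- Every set of pairwise intersecting arcs has a common point. -/
def Helly (A : PreArcModel V) : Prop :=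
  ∀ S : Set V, (∀ u ∈ S, ∀ v ∈ S, (A.arc u ∩ A.arc v).Nonempty) →
    (⋂ v ∈ S, A.arc v).Nonempty

/-- The set `K_A(α)` of vertices whose arc contains the point `α`. -/
noncomputable def K (A : PreArcModel V) (α : AddCircle A.L) : Set V := {v | α ∈ A.arc v}

/-- The edge set `E→_A(α)`: edges `vu` of `G` with `v ∈ K_A(α)`, `u ∉ K_A(α)`,
and `A(v)` intersecting `A(u)` from the left (`cp v ∈ A(u)`). -/
noncomputable def Eout (A : PreArcModel V) (G : SimpleGraph V) (α : AddCircle A.L) :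
    Set (Sym2 V) :=
  {e | ∃ v u : V, e = s(v, u) ∧ G.Adj v u ∧ α ∈ A.arc v ∧ α ∉ A.arc u ∧ A.cp v ∈ A.arc u}

/-- The edge set `E→_{A - Vm}(α)` of the model obtained by removing the arcs of `Vm`. -/
noncomputable def EoutAvoid (A : PreArcModel V) (G : SimpleGraph V) (Vm : Set V)
    (α : AddCircle A.L) : Set (Sym2 V) :=
  {e | ∃ v u : V, e = s(v, u) ∧ G.Adj v u ∧ v ∉ Vm ∧ u ∉ Vm ∧
    α ∈ A.arc v ∧ α ∉ A.arc u ∧ A.cp v ∈ A.arc u}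

end PreArcModel

/-- A proper Helly circular-arc graph: a graph admitting an arc model that is both
proper and Helly. -/
def SimpleGraph.IsPHCA {V : Type*} (G : SimpleGraph V) : Prop :=
  ∃ A : PreArcModel V, A.IsModelOf G ∧ A.Proper ∧ A.Helly

/-- Adjacency pattern of a fat `W_5` among the six clique-classes: classes `0..4`
form the fat hole (consecutive classes modulo 5 are completely adjacent), class `5`
is the hub (completely adjacent to everything), and each class is a clique. -/
def fatW5Rel (p q : Fin 6) : Prop :=
  p = q ∨ p = 5 ∨ q = 5 ∨ (p.val + 1) % 5 = q.val ∨ (q.val + 1) % 5 = p.val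

/-- A fat `W_5`: vertex set partitioned into six nonempty cliques with the `W_5`
adjacency pattern between the classes. -/
def SimpleGraph.IsFatW5 {V : Type*} (G : SimpleGraph V) : Prop :=
  ∃ part : V → Fin 6, Function.Surjective part ∧
    ∀ u v : V, u ≠ v → (G.Adj u v ↔ fatW5Rel (part u) (part v))

/-- `Gb` is a maximum spanning unit interval subgraph of `G`. -/
def IsMaxSpanningUIG {V : Type*} (G Gb : SimpleGraph V) : Prop :=
  Gb ≤ G ∧ Gb.IsUnitIntervalGraph ∧
    ∀ H : SimpleGraph V, H ≤ G → H.IsUnitIntervalGraph →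
      H.edgeSet.ncard ≤ Gb.edgeSet.ncard

/-- `(Vm, Em, Ep)` is an editing set of `G`: `Em` is a set of edges of `G - Vm`,
`Ep` a set of non-edges of `G - Vm`, and deleting `Em` and adding `Ep` makes
`G - Vm` a unit interval graph. -/
def IsEditingSet {V : Type*} (G : SimpleGraph V) (Vm : Set V) (Em Ep : Set (Sym2 V)) : Prop :=
  Em ⊆ G.edgeSet ∧ (∀ e ∈ Em, ∀ x ∈ e, x ∉ Vm) ∧
  (∀ e ∈ Ep, ¬ e.IsDiag ∧ e ∉ G.edgeSet ∧ ∀ x ∈ e, x ∉ Vm) ∧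
  ((SimpleGraph.fromEdgeSet ((G.edgeSet \ Em) ∪ Ep)).induce {v | v ∉ Vm}).IsUnitIntervalGraph

theorem hasInducedCopy_claw {V : Type*} {G : SimpleGraph V} {p a b c : V}
    (ha : G.Adj p a) (hb : G.Adj p b) (hc : G.Adj p c) (hab : a ≠ b) (hac : a ≠ c) (hbc : b ≠ c)
    (nab : ¬ G.Adj a b) (nac : ¬ G.Adj a c) (nbc : ¬ G.Adj b c) :
    G.HasInducedCopy clawGraph := by
  have := ha.ne; have := hb.ne; have := hc.ne
  refine ⟨![p, a, b, c], ?_, ?_⟩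
  · intro i j
    fin_cases i <;> fin_cases j <;> simp_all [eq_comm]
  · intro i j
    fin_cases i <;> fin_cases j <;> simp_all [clawGraph, G.adj_comm, eq_comm]

theorem SimpleGraph.IsUnitIntervalGraph.not_claw {V : Type*} {G : SimpleGraph V}
    (h : G.IsUnitIntervalGraph) : ¬ G.HasInducedCopy clawGraph := by
  obtain ⟨f, hf⟩ := h
  rintro ⟨g, hg, hadj⟩
  have key : ∀ i j, i ≠ j → (clawGraph.Adj i j ↔ |f (g i) - f (g j)| ≤ 1) :=
    fun i j hij => (hadj i j).symm.trans (hf _ _ (hg.ne hij))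
  have h1 := key 0 1 (by decide)
  have h2 := key 0 2 (by decide)
  have h3 := key 0 3 (by decide)
  have h4 := key 1 2 (by decide)
  have h5 := key 1 3 (by decide)
  have h6 := key 2 3 (by decide)
  simp [clawGraph, abs_le] at h1 h2 h3 h4 h5 h6
  grind

theorem SimpleGraph.IsUnitIntervalGraph.not_tent {V : Type*} {G : SimpleGraph V}
    (h : G.IsUnitIntervalGraph) : ¬ G.HasInducedCopy tentGraph := by
  obtain ⟨f, hf⟩ := h
  rintro ⟨g, hg, hadj⟩
  have key : ∀ i j, i ≠ j → (tentGraph.Adj i j ↔ |f (g i) - f (g j)| ≤ 1) :=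
    fun i j hij => (hadj i j).symm.trans (hf _ _ (hg.ne hij))
  have h1 := key 3 4 (by decide)
  have h2 := key 3 5 (by decide)
  have h3 := key 4 5 (by decide)
  have h4 := key 0 4 (by decide)
  have h5 := key 0 5 (by decide)
  have h6 := key 1 3 (by decide)
  have h7 := key 1 5 (by decide)
  have h8 := key 2 3 (by decide)
  have h9 := key 2 4 (by decide)
  simp [tentGraph, abs_le] at h1 h2 h3 h4 h5 h6 h7 h8 h9
  grind

theorem SimpleGraph.IsUnitIntervalGraph.not_net {V : Type*} {G : SimpleGraph V}
    (h : G.IsUnitIntervalGraph) : ¬ G.HasInducedCopy netGraph := by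
  obtain ⟨f, hf⟩ := h
  rintro ⟨g, hg, hadj⟩
  have key : ∀ i j, i ≠ j → (netGraph.Adj i j ↔ |f (g i) - f (g j)| ≤ 1) :=
    fun i j hij => (hadj i j).symm.trans (hf _ _ (hg.ne hij))
  have h01 := key 0 1 (by decide)
  have h02 := key 0 2 (by decide)
  have h12 := key 1 2 (by decide)
  have h03 := key 0 3 (by decide)
  have h14 := key 1 4 (by decide)
  have h25 := key 2 5 (by decide)
  have h34 := key 3 4 (by decide)
  have h35 := key 3 5 (by decide)
  have h45 := key 4 5 (by decide)
  have h04 := key 0 4 (by decide)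
  have h05 := key 0 5 (by decide)
  have h13 := key 1 3 (by decide)
  have h15 := key 1 5 (by decide)
  have h23 := key 2 3 (by decide)
  have h24 := key 2 4 (by decide)
  simp [netGraph, abs_le] at h01 h02 h12 h03 h14 h25 h34 h35 h45 h04 h05 h13 h15 h23 h24
  grind

theorem SimpleGraph.IsUnitIntervalGraph.not_hole {V : Type*} {G : SimpleGraph V}
    (h : G.IsUnitIntervalGraph) : ¬ G.HasHole := by
  obtain ⟨f, hf⟩ := h
  rintro ⟨n, g, hn, hg, hadj⟩
  have : NeZero n := ⟨by omega⟩
  obtain ⟨i, hi⟩ := Finite.exists_min (fun i => f (g i))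
  have hk : ∀ k : ℕ, 0 < k → k < 4 → (k : ZMod n) ≠ 0 := fun k hk hk4 h0 =>
    absurd (Nat.le_of_dvd hk ((ZMod.natCast_eq_zero_iff k n).1 h0)) (by omega)
  have h1 : (1 : ZMod n) ≠ 0 := by exact_mod_cast hk 1 (by norm_num) (by norm_num)
  have h2 : (2 : ZMod n) ≠ 0 := by exact_mod_cast hk 2 (by norm_num) (by norm_num)
  have h3 : (3 : ZMod n) ≠ 0 := by exact_mod_cast hk 3 (by norm_num) (by norm_num)
  have key : ∀ i j, i ≠ j → ((i = j + 1 ∨ j = i + 1) ↔ |f (g i) - f (g j)| ≤ 1) :=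
    fun i j hij => (hadj i j).symm.trans (hf _ _ (hg.ne hij))
  have a1 := (key i (i + 1) (fun h => h1 (by linear_combination -h))).1 (.inr rfl)
  have a2 := (key i (i - 1) (fun h => h1 (by linear_combination h))).1 (.inl (by ring))
  have a3 := mt (key (i + 1) (i - 1) (fun h => h2 (by linear_combination h))).2 (by
    rintro (h | h)
    · exact h1 (by linear_combination h)
    · exact h3 (by linear_combination -h))
  have b1 := hi (i + 1)
  have b2 := hi (i - 1)
  simp only [abs_le, not_and_or, not_le] at a1 a2 a3 b1 b2
  grind

theorem hasInducedCopy_tent {V : Type*} {G : SimpleGraph V} {a b c x y z : V}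
    (hab : G.Adj a b) (hac : G.Adj a c) (hbc : G.Adj b c)
    (hbx : G.Adj b x) (hcx : G.Adj c x) (hay : G.Adj a y) (hcy : G.Adj c y)
    (haz : G.Adj a z) (hbz : G.Adj b z)
    (nax : ¬ G.Adj a x) (nby : ¬ G.Adj b y) (ncz : ¬ G.Adj c z)
    (nxy : ¬ G.Adj x y) (nxz : ¬ G.Adj x z) (nyz : ¬ G.Adj y z) :
    G.HasInducedCopy tentGraph := by
  have := hab.ne; have := hac.ne; have := hbc.ne; have := hbx.ne; have := hcx.ne
  have := hay.ne; have := hcy.ne; have := haz.ne; have := hbz.ne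
  have : a ≠ x := by rintro rfl; exact nxy hay
  have : b ≠ y := by rintro rfl; exact nyz hbz
  have : c ≠ z := by rintro rfl; exact nyz hcy.symm
  have : x ≠ y := by rintro rfl; exact nax hay
  have : x ≠ z := by rintro rfl; exact nax haz
  have : y ≠ z := by rintro rfl; exact nby hbz
  refine ⟨![a, b, c, x, y, z], ?_, ?_⟩
  · intro i j
    fin_cases i <;> fin_cases j <;> simp_all [eq_comm]
  · intro i j
    fin_cases i <;> fin_cases j <;> simp_all [tentGraph, G.adj_comm, eq_comm]

theorem hasInducedCopy_net {V : Type*} {G : SimpleGraph V} {a b c x y z : V}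
    (hab : G.Adj a b) (hac : G.Adj a c) (hbc : G.Adj b c)
    (hax : G.Adj a x) (hby : G.Adj b y) (hcz : G.Adj c z)
    (nay : ¬ G.Adj a y) (naz : ¬ G.Adj a z) (nbx : ¬ G.Adj b x) (nbz : ¬ G.Adj b z)
    (ncx : ¬ G.Adj c x) (ncy : ¬ G.Adj c y)
    (nxy : ¬ G.Adj x y) (nxz : ¬ G.Adj x z) (nyz : ¬ G.Adj y z) :
    G.HasInducedCopy netGraph := by
  have := hab.ne; have := hac.ne; have := hbc.ne; have := hax.ne; have := hby.ne
  have := hcz.ne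
  have : a ≠ y := by rintro rfl; exact ncy hac.symm
  have : a ≠ z := by rintro rfl; exact nbz hab.symm
  have : b ≠ x := by rintro rfl; exact ncx hbc.symm
  have : b ≠ z := by rintro rfl; exact naz hab
  have : c ≠ x := by rintro rfl; exact nbx hbc
  have : c ≠ y := by rintro rfl; exact nay hac
  have : x ≠ y := by rintro rfl; exact nay hax
  have : x ≠ z := by rintro rfl; exact naz hax
  have : y ≠ z := by rintro rfl; exact nbz hby
  refine ⟨![a, b, c, x, y, z], ?_, ?_⟩
  · intro i j
    fin_cases i <;> fin_cases j <;> simp_all [eq_comm]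
  · intro i j
    fin_cases i <;> fin_cases j <;> simp_all [netGraph, G.adj_comm, eq_comm]

/-- A cyclic sequence of at least four distinct vertices whose only adjacencies are between
cyclically consecutive ones is a hole. -/
theorem hasHole_of_cyclic_sequence {V : Type*} {G : SimpleGraph V} {n : ℕ} (hn : 3 ≤ n)
    (c : ℕ → V) (hne : ∀ i j, i < j → j ≤ n → c i ≠ c j)
    (hadj : ∀ i j, i < j → j ≤ n → (G.Adj (c i) (c j) ↔ (j = i + 1 ∨ (i = 0 ∧ j = n)))) :
    G.HasHole := by
  have hlt : ∀ i : ZMod (n + 1), i.val ≤ n := fun i => Nat.lt_succ_iff.1 (ZMod.val_lt i)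
  have hsucc : ∀ i j : ZMod (n + 1), i = j + 1 ↔
      (i.val = j.val + 1 ∨ (i.val = 0 ∧ j.val = n)) := by
    intro i j
    rw [← (ZMod.val_injective (n + 1)).eq_iff, ZMod.val_add,
      ZMod.val_one'' (by omega)]
    have hi := hlt i
    have hj := hlt j
    rcases hj.lt_or_eq with h | h
    · rw [Nat.mod_eq_of_lt (by omega)]
      omega
    · rw [h, Nat.mod_self]
      omega
  refine ⟨n + 1, fun i => c i.val, by omega, ?_, ?_⟩
  · intro i j hij
    by_contra h
    have hv : i.val ≠ j.val := fun h' => h (ZMod.val_injective _ h')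
    rcases hv.lt_or_gt with h' | h'
    · exact hne _ _ h' (hlt j) hij
    · exact hne _ _ h' (hlt i) hij.symm
  · intro i j
    have hi := hlt i
    have hj := hlt j
    rw [hsucc, hsucc]
    rcases lt_trichotomy i.val j.val with h | h | h
    · rw [hadj _ _ h hj]
      omega
    · simp only [h, SimpleGraph.irrefl, false_iff]
      omega
    · rw [G.adj_comm, hadj _ _ h hi]
      omega

theorem hasHole_of_square {V : Type*} {G : SimpleGraph V} {a b c d : V}
    (hab : G.Adj a b) (hbc : G.Adj b c) (hcd : G.Adj c d) (hda : G.Adj d a)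
    (hac : a ≠ c) (hbd : b ≠ d) (nac : ¬ G.Adj a c) (nbd : ¬ G.Adj b d) : G.HasHole := by
  have := hab.ne; have := hbc.ne; have := hcd.ne; have := hda.ne
  refine hasHole_of_cyclic_sequence (n := 3) le_rfl
    (fun i => if i = 0 then a else if i = 1 then b else if i = 2 then c else d) ?_ ?_
  · intro i j hij hj
    interval_cases j <;> interval_cases i <;> simp_all [eq_comm]
  · intro i j hij hj
    interval_cases j <;> interval_cases i <;> simp_all [G.adj_comm]

/-- Along a shortest walk, the distance from the source grows by one in each step. -/
theorem SimpleGraph.Walk.dist_getVert {V : Type*} {G : SimpleGraph V} {u v : V} (p : G.Walk u v)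
    (hp : p.length = G.dist u v) {i : ℕ} (hi : i ≤ p.length) : G.dist u (p.getVert i) = i := by
  have h1 := dist_le (p.take i)
  have h2 := (p.take i).reachable.dist_triangle_left v
  have h3 := dist_le (p.drop i)
  rw [Walk.take_length] at h1
  rw [Walk.drop_length] at h3
  omega

/-- The edges of `G` inside `B`, without the edge `pq`. -/
def SimpleGraph.insideMinus {V : Type*} (G : SimpleGraph V) (B : Set V) (p q : V) :
    SimpleGraph V where
  Adj a b := G.Adj a b ∧ a ∈ B ∧ b ∈ B ∧ ¬ (a = p ∧ b = q) ∧ ¬ (a = q ∧ b = p)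
  symm := ⟨fun _ _ h => ⟨h.1.symm, h.2.2.1, h.2.1, fun h' => h.2.2.2.2 h'.symm,
    fun h' => h.2.2.2.1 h'.symm⟩⟩
  loopless := ⟨fun _ h => G.irrefl h.1⟩

/-- If an edge `pq` lies on a cycle inside `B` but on no triangle inside `B`, there is a hole. -/
theorem hasHole_of_insideMinus_reachable {V : Type*} {G : SimpleGraph V} {B : Set V} {p q : V}
    (hpq : G.Adj p q) (hq : q ∈ B)
    (htri : ∀ c ∈ B, G.Adj p c → ¬ G.Adj q c)
    (hr : (G.insideMinus B p q).Reachable p q) : G.HasHole := by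
  set H := G.insideMinus B p q with hH
  obtain ⟨w, hw⟩ := hr.exists_walk_length_eq_dist
  have hd : ∀ i ≤ w.length, H.dist p (w.getVert i) = i := fun i hi => w.dist_getVert hw hi
  have hstep : ∀ i < w.length, H.Adj (w.getVert i) (w.getVert (i + 1)) :=
    fun i hi => w.adj_getVert_succ hi
  have hB : ∀ i ≤ w.length, w.getVert i ∈ B := by
    intro i hi
    rcases hi.lt_or_eq with h | rfl
    · exact (hstep i h).2.1
    · simpa using hq
  have hne : ∀ i j, i < j → j ≤ w.length → w.getVert i ≠ w.getVert j := by
    intro i j hij hj h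
    have h1 := hd i (by omega)
    have h2 := hd j hj
    rw [h] at h1
    omega
  have h0 : w.getVert 0 = p := w.getVert_zero
  have hn : w.getVert w.length = q := w.getVert_length
  have hlen : 3 ≤ w.length := by
    by_contra hlt
    have : w.length = 0 ∨ w.length = 1 ∨ w.length = 2 := by omega
    rcases this with h | h | h
    · rw [h, h0] at hn
      exact hpq.ne hn
    · have := hstep 0 (by omega)
      rw [h] at hn
      rw [h0, zero_add, hn] at this
      exact this.2.2.2.1 ⟨rfl, rfl⟩
    · have e1 := hstep 0 (by omega)
      have e2 := hstep 1 (by omega)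
      rw [h] at hn
      rw [h0, zero_add] at e1
      rw [show 1 + 1 = 2 from rfl, hn] at e2
      exact htri _ e1.2.2.1 e1.1 e2.1.symm
  refine hasHole_of_cyclic_sequence hlen w.getVert hne ?_
  intro i j hij hj
  constructor
  · intro h
    by_cases hend : i = 0 ∧ j = w.length
    · exact .inr hend
    left
    have hHadj : H.Adj (w.getVert i) (w.getVert j) := by
      refine ⟨h, hB i (by omega), hB j hj, ?_, ?_⟩
      · rintro ⟨hi', hj'⟩
        replace hi' := hi'.trans h0.symm
        replace hj' := hj'.trans hn.symm
        refine hend ⟨?_, ?_⟩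
        · by_contra hi0
          exact hne 0 i (by omega) (by omega) hi'.symm
        · by_contra hjn
          exact hne j w.length (by omega) le_rfl hj'
      · rintro ⟨hi', -⟩
        exact hne i w.length (by omega) le_rfl (hi'.trans hn.symm)
    have h1 := hHadj.diff_dist_adj (u := p)
    rw [hd i (by omega), hd j hj] at h1
    omega
  · rintro (rfl | ⟨rfl, rfl⟩)
    · exact (hstep i (by omega)).1
    · rw [h0, hn]
      exact hpq

/-- A graph with a vertex ordering in which every vertex lying between two adjacent vertices is
adjacent to both is a unit interval graph. -/
theorem isUnitIntervalGraph_of_umbrella {V α : Type*} [Fintype V] [LinearOrder α]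
    {G : SimpleGraph V} (k : V → α)
    (hk : ∀ u v w, u ≠ v → v ≠ w → k u ≤ k v → k v ≤ k w → G.Adj u w →
      G.Adj u v ∧ G.Adj v w) : G.IsUnitIntervalGraph := by
  classical
  suffices h : ∀ s : Finset V, ∃ f : V → ℝ,
      (∀ u ∈ s, ∀ v ∈ s, u ≠ v → f u ≠ f v) ∧
      (∀ u ∈ s, ∀ v ∈ s, f u < f v → k u ≤ k v ∧ (G.Adj u v → f v < f u + 1) ∧
        (¬ G.Adj u v → f u + 1 < f v)) by
    obtain ⟨f, hinj, hf⟩ := h Finset.univ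
    refine ⟨f, fun u v huv => ?_⟩
    rcases (hinj u (Finset.mem_univ _) v (Finset.mem_univ _) huv).lt_or_gt with h | h
    · obtain ⟨-, h1, h2⟩ := hf u (Finset.mem_univ _) v (Finset.mem_univ _) h
      rw [abs_le]
      by_cases ha : G.Adj u v
      · have := h1 ha
        exact ⟨fun _ => ⟨by linarith, by linarith⟩, fun _ => ha⟩
      · have := h2 ha
        exact ⟨fun h => (ha h).elim, fun h => by linarith⟩
    · obtain ⟨-, h1, h2⟩ := hf v (Finset.mem_univ _) u (Finset.mem_univ _) h
      rw [abs_le, G.adj_comm]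
      by_cases ha : G.Adj v u
      · have := h1 ha
        exact ⟨fun _ => ⟨by linarith, by linarith⟩, fun _ => ha⟩
      · have := h2 ha
        exact ⟨fun h => (ha h).elim, fun h => by linarith⟩
  intro s
  induction s using Finset.induction_on_max_value k with
  | empty => exact ⟨fun _ => 0, by simp, by simp⟩
  | insert a s has hmax ih =>
    obtain ⟨f, hinj, hf⟩ := ih
    obtain ⟨y, hy⟩ : ∃ y : ℝ, ∀ x ∈ s, f x < y ∧ (G.Adj x a → y < f x + 1) ∧
        (¬ G.Adj x a → f x + 1 < y) := by
      rcases (s.filter (fun x => G.Adj x a)).eq_empty_or_nonempty with hN | hN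
      · have hnon : ∀ x ∈ s, ¬ G.Adj x a := fun x hx ha =>
          Finset.notMem_empty x (hN ▸ Finset.mem_filter.2 ⟨hx, ha⟩)
        have : ∀ᶠ y : ℝ in Filter.atTop, ∀ x ∈ s, f x + 1 < y :=
          (Filter.eventually_all_finset s).2 fun x _ => Filter.eventually_gt_atTop _
        obtain ⟨y, hy⟩ := this.exists
        exact ⟨y, fun x hx => ⟨by linarith [hy x hx], fun h => (hnon x hx h).elim,
          fun _ => hy x hx⟩⟩
      · obtain ⟨l, hl, hlmin⟩ := Finset.exists_min_image _ f hN
        obtain ⟨hls, hla⟩ := Finset.mem_filter.1 hl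
        have hnon : ∀ x ∈ s, ¬ G.Adj x a → f x < f l := by
          intro x hx hxa
          have hne : l ≠ x := by rintro rfl; exact hxa hla
          by_contra hlt
          have hlx := lt_of_le_of_ne (not_lt.1 hlt) (hinj l hls x hx hne)
          exact hxa (hk l x a hne (fun h => has (h ▸ hx)) (hf l hls x hx hlx).1 (hmax x hx)
            hla).2
        have hlt : ∀ x ∈ s, f x < f l + 1 := by
          intro x hx
          by_cases hxa : G.Adj x a
          · rcases eq_or_ne l x with rfl | hne
            · linarith
            have hlx := lt_of_le_of_ne (hlmin x (Finset.mem_filter.2 ⟨hx, hxa⟩))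
              (hinj l hls x hx hne)
            obtain ⟨h1, h2, -⟩ := hf l hls x hx hlx
            exact h2 (hk l x a hne (fun h => has (h ▸ hx)) h1 (hmax x hx) hla).1
          · linarith [hnon x hx hxa]
        have : ∀ᶠ y : ℝ in nhdsWithin (f l + 1) (Set.Iio (f l + 1)), (∀ x ∈ s, f x < y ∧
            (¬ G.Adj x a → f x + 1 < y)) ∧ y < f l + 1 := by
          refine ((Filter.eventually_all_finset s).2 fun x hx => ?_).and self_mem_nhdsWithin
          refine (eventually_nhdsWithin_of_eventually_nhds
            (eventually_gt_nhds (hlt x hx))).and ?_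
          by_cases hxa : G.Adj x a
          · exact Filter.Eventually.of_forall fun _ h => (h hxa).elim
          · refine (eventually_nhdsWithin_of_eventually_nhds (eventually_gt_nhds
              (show f x + 1 < f l + 1 by linarith [hnon x hx hxa]))).mono fun _ h _ => h
        obtain ⟨y, hy, hyl⟩ := this.exists
        refine ⟨y, fun x hx => ⟨(hy x hx).1, fun hxa => ?_, (hy x hx).2⟩⟩
        linarith [hlmin x (Finset.mem_filter.2 ⟨hx, hxa⟩)]
    have hfs : ∀ x ∈ s, Function.update f a y x = f x := fun x hx =>
      Function.update_of_ne (fun h : x = a => has (h ▸ hx)) _ _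
    have hfa : Function.update f a y a = y := Function.update_self _ _ _
    refine ⟨Function.update f a y, ?_, ?_⟩
    · intro u hu v hv huv
      rcases Finset.mem_insert.1 hu with rfl | hu' <;> rcases Finset.mem_insert.1 hv with rfl | hv'
      · exact (huv rfl).elim
      · rw [hfa, hfs v hv']
        exact (hy v hv').1.ne'
      · rw [hfa, hfs u hu']
        exact (hy u hu').1.ne
      · rw [hfs u hu', hfs v hv']
        exact hinj u hu' v hv' huv
    · intro u hu v hv
      rcases Finset.mem_insert.1 hu with rfl | hu' <;> rcases Finset.mem_insert.1 hv with rfl | hv'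
      · exact fun h => (lt_irrefl _ h).elim
      · rw [hfa, hfs v hv']
        exact fun h => (lt_asymm h (hy v hv').1).elim
      · rw [hfa, hfs u hu']
        exact fun _ => ⟨hmax u hu', (hy u hu').2⟩
      · rw [hfs u hu', hfs v hv']
        exact hf u hu' v hv'

/-- The edges of `G` outside the closed neighborhood of `z`. -/
def SimpleGraph.avoidNeighbors {V : Type*} (G : SimpleGraph V) (z : V) : SimpleGraph V where
  Adj a b := G.Adj a b ∧ (a ≠ z ∧ ¬ G.Adj z a) ∧ (b ≠ z ∧ ¬ G.Adj z b)
  symm := ⟨fun _ _ h => ⟨h.1.symm, h.2.2, h.2.1⟩⟩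
  loopless := ⟨fun _ h => G.irrefl h.1⟩

theorem SimpleGraph.Reachable.induction_adj {V : Type*} {H : SimpleGraph V} {c x : V}
    {P : V → Prop} (h : H.Reachable c x) (h0 : P c)
    (hs : ∀ a b, H.Reachable c a → H.Adj a b → P a → P b) : P x := by
  rw [SimpleGraph.reachable_iff_reflTransGen] at h
  induction h with
  | refl => exact h0
  | tail h1 h2 ih => exact hs _ _ ((SimpleGraph.reachable_iff_reflTransGen _ _).2 h1) h2 ih

/-- Every component of a claw-, tent- and hole-free finite graph has a vertex such that the
vertices at distance one from it form a clique, and so do the vertices at distance two. -/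
theorem exists_extreme_vertex {V : Type*} [Finite V] {G : SimpleGraph V}
    (hclaw : ¬ G.HasInducedCopy clawGraph) (htent : ¬ G.HasInducedCopy tentGraph)
    (hhole : ¬ G.HasHole) (o : V) :
    ∃ z, G.Reachable o z ∧ (∀ a b, G.Adj z a → G.Adj z b → a ≠ b → G.Adj a b) ∧
      (∀ p q x y, G.Adj z p → G.Adj p x → x ≠ z → ¬ G.Adj z x →
        G.Adj z q → G.Adj q y → y ≠ z → ¬ G.Adj z y → x ≠ y → G.Adj x y) := by
  have claw : ∀ {p a b c : V}, G.Adj p a → G.Adj p b → G.Adj p c → a ≠ b → a ≠ c → b ≠ c →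
      ¬ G.Adj a b → ¬ G.Adj a c → G.Adj b c := fun h1 h2 h3 h4 h5 h6 h7 h8 =>
    not_not.1 fun h9 => hclaw (hasInducedCopy_claw h1 h2 h3 h4 h5 h6 h7 h8 h9)
  let P : Set (V × V) := {t | G.Reachable o t.1 ∧ G.Reachable o t.2 ∧ t.2 ≠ t.1 ∧
    ¬ G.Adj t.1 t.2}
  rcases P.eq_empty_or_nonempty with hP | hP
  · have hall : ∀ a b, G.Reachable o a → G.Reachable o b → b ≠ a → G.Adj a b := by
      intro a b ha hb hne
      by_contra hab
      exact Set.notMem_empty (a, b) (hP ▸ ⟨ha, hb, hne, hab⟩)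
    refine ⟨o, .rfl, fun a b ha hb hne => hall a b ha.reachable hb.reachable hne.symm, ?_⟩
    intro p q x y hp hpx hxz hzx
    exact (hzx (hall o x .rfl (hp.reachable.trans hpx.reachable) hxz)).elim
  obtain ⟨⟨z, c⟩, ⟨hoz, hoc, hcz, hzc⟩, hmax⟩ := Set.exists_max_image P
    (fun t => {x | (G.avoidNeighbors t.1).Reachable t.2 x}.ncard) P.toFinite hP
  dsimp only at hoz hoc hcz hzc hmax
  set C : Set V := {x | (G.avoidNeighbors z).Reachable c x} with hC
  have hcC : c ∈ C := .rfl
  have hCavoid : ∀ x ∈ C, x ≠ z ∧ ¬ G.Adj z x := fun x hx =>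
    SimpleGraph.Reachable.induction_adj (P := fun x => x ≠ z ∧ ¬ G.Adj z x) hx ⟨hcz, hzc⟩
      fun _ _ _ h _ => h.2.2
  have hCclosed : ∀ x ∈ C, ∀ y, G.Adj x y → y ≠ z → ¬ G.Adj z y → y ∈ C := by
    intro x hx y hxy hy hzy
    have : (G.avoidNeighbors z).Adj x y := ⟨hxy, hCavoid x hx, hy, hzy⟩
    exact SimpleGraph.Reachable.trans hx this.reachable
  have hCreach : ∀ H : SimpleGraph V, (∀ a ∈ C, ∀ b ∈ C, G.Adj a b → H.Adj a b) →
      ∀ x ∈ C, H.Reachable c x := by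
    intro H hH x hx
    refine SimpleGraph.Reachable.induction_adj (P := fun x => H.Reachable c x) hx .rfl ?_
    intro a b ha hab hr
    exact hr.trans (hH a ha b (ha.trans hab.reachable) hab.1).reachable
  have hCo : ∀ x ∈ C, G.Reachable o x := fun x hx =>
    hoc.trans (hCreach G (fun _ _ _ _ h => h) x hx)
  have hS : ∀ x ∈ C, ∀ y, y ∉ C → G.Adj x y → G.Adj z y := by
    intro x hx y hy hxy
    by_contra hzy
    refine hy (hCclosed x hx y hxy ?_ hzy)
    rintro rfl
    exact (hCavoid x hx).2 hxy.symm
  have hzC : z ∉ C := fun h => (hCavoid z h).1 rfl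
  have hRS : ∀ v, G.Reachable o v → v ∉ C → (∀ x ∈ C, ¬ G.Adj x v) →
      ∀ s, s ∉ C → (∃ x ∈ C, G.Adj x s) → G.Adj v s := by
    rintro v hov hvC hv s hsC ⟨x, hx, hxs⟩
    by_contra hvs
    have havoid : ∀ a ∈ C, a ≠ v ∧ ¬ G.Adj v a := fun a ha =>
      ⟨fun h => hvC (h ▸ ha), fun h => hv a ha h.symm⟩
    have hsub : ∀ a ∈ C, (G.avoidNeighbors v).Reachable c a :=
      hCreach _ fun a ha b hb hab => ⟨hab, havoid a ha, havoid b hb⟩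
    have hs : (G.avoidNeighbors v).Reachable c s := by
      have : (G.avoidNeighbors v).Adj x s :=
        ⟨hxs, havoid x hx, fun h => hv x hx (h ▸ hxs), hvs⟩
      exact (hsub x hx).trans this.reachable
    refine (hmax (v, c) ⟨hov, hoc, (havoid c hcC).1, (havoid c hcC).2⟩).not_gt ?_
    exact Set.ncard_lt_ncard ⟨hsub, fun h => hsC (h hs)⟩ (Set.toFinite _)
  obtain ⟨x₀, hx₀, s₀, hs₀, hxs₀⟩ : ∃ x ∈ C, ∃ s, s ∉ C ∧ G.Adj x s := by
    by_contra! hno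
    refine hzC (SimpleGraph.Reachable.induction_adj (P := fun x => x ∈ C)
      (hoc.symm.trans hoz) hcC ?_)
    intro a b _ hab ha
    by_contra hb
    exact hno a ha b hb hab
  have hR : ∀ v w, G.Reachable o v → v ∉ C → (∀ x ∈ C, ¬ G.Adj x v) →
      G.Reachable o w → w ∉ C → (∀ x ∈ C, ¬ G.Adj x w) → v ≠ w → G.Adj v w := by
    intro v w hov hvC hv how hwC hw hne
    exact claw hxs₀.symm (hRS v hov hvC hv s₀ hs₀ ⟨x₀, hx₀, hxs₀⟩).symm
      (hRS w how hwC hw s₀ hs₀ ⟨x₀, hx₀, hxs₀⟩).symm (fun h => hvC (h ▸ hx₀))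
      (fun h => hwC (h ▸ hx₀)) hne (hv _ hx₀) (hw _ hx₀)
  have hzN : ∀ x ∈ C, ¬ G.Adj x z := fun x hx h => (hCavoid x hx).2 h.symm
  have hclique : ∀ a b, G.Adj z a → G.Adj z b → a ≠ b → G.Adj a b := by
    intro a b ha hb hab
    have haC : a ∉ C := fun h => (hCavoid a h).2 ha
    have hbC : b ∉ C := fun h => (hCavoid b h).2 hb
    by_cases hSa : ∃ x ∈ C, G.Adj x a
    · by_cases hSb : ∃ x ∈ C, G.Adj x b
      · by_contra hnab
        obtain ⟨x, hx, hxa⟩ := hSa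
        obtain ⟨y, hy, hyb⟩ := hSb
        refine hhole (hasHole_of_insideMinus_reachable (B := C ∪ {z, a, b}) ha (by simp) ?_ ?_)
        · rintro v (hv | rfl | rfl | rfl) hzv hav
          · exact (hCavoid v hv).2 hzv
          · exact G.irrefl hzv
          · exact G.irrefl hav
          · exact hnab hav
        · have hCH := hCreach (G.insideMinus (C ∪ {z, a, b}) z a) fun u hu v hv huv =>
            ⟨huv, .inl hu, .inl hv, fun h => hzC (h.1 ▸ hu), fun h => hzC (h.2 ▸ hv)⟩
          have e1 : (G.insideMinus (C ∪ {z, a, b}) z a).Adj z b :=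
            ⟨hb, by simp, by simp, fun h => hab h.2.symm, fun h => ha.ne h.1⟩
          have e2 : (G.insideMinus (C ∪ {z, a, b}) z a).Adj y b :=
            ⟨hyb, .inl hy, by simp, fun h => hzC (h.1 ▸ hy), fun h => haC (h.1 ▸ hy)⟩
          have e3 : (G.insideMinus (C ∪ {z, a, b}) z a).Adj x a :=
            ⟨hxa, .inl hx, by simp, fun h => hzC (h.1 ▸ hx), fun h => haC (h.1 ▸ hx)⟩
          exact e1.reachable.trans (e2.symm.reachable.trans
            ((hCH y hy).symm.trans ((hCH x hx).trans e3.reachable)))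
      · push Not at hSb
        exact (hRS b (hoz.trans hb.reachable) hbC hSb a haC hSa).symm
    · push Not at hSa
      by_cases hSb : ∃ x ∈ C, G.Adj x b
      · exact hRS a (hoz.trans ha.reachable) haC hSa b hbC hSb
      · push Not at hSb
        exact hR a b (hoz.trans ha.reachable) haC hSa (hoz.trans hb.reachable) hbC hSb hab
  have hmem : ∀ p x, G.Adj z p → G.Adj p x → x ≠ z → ¬ G.Adj z x → x ∈ C := by
    intro p x hzp hpx hxz hzx
    by_contra hxC
    refine hzx (hR z x hoz hzC hzN (hoz.trans (hzp.reachable.trans hpx.reachable)) hxC ?_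
      hxz.symm)
    exact fun y hy hyx => hzx (hS y hy x hxC hyx)
  refine ⟨z, hoz, hclique, ?_⟩
  intro p q x y hzp hpx hxz hzx hzq hqy hyz hzy hxy
  have hxC := hmem p x hzp hpx hxz hzx
  have hyC := hmem q y hzq hqy hyz hzy
  have hnbr : ∀ s, G.Adj z s → ∀ u ∈ C, ∀ v ∈ C, G.Adj s u → G.Adj s v → u ≠ v →
      G.Adj u v := fun s hs u hu v hv hsu hsv huv =>
    claw hs.symm hsu hsv (hCavoid u hu).1.symm (hCavoid v hv).1.symm huv (hCavoid u hu).2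
      (hCavoid v hv).2
  by_contra hnxy
  have hpy : ¬ G.Adj p y := fun h => hnxy (hnbr p hzp x hxC y hyC hpx h hxy)
  have hqx : ¬ G.Adj q x := fun h => hnxy (hnbr q hzq x hxC y hyC h hqy hxy)
  have hpq : G.Adj p q := hclique p q hzp hzq (fun h => hpy (h ▸ hqy))
  have hpC : p ∉ C := fun h => (hCavoid p h).2 hzp
  have hqC : q ∉ C := fun h => (hCavoid q h).2 hzq
  by_cases hcommon : ∃ v ∈ C, G.Adj p v ∧ G.Adj q v
  · obtain ⟨v, hv, hpv, hqv⟩ := hcommon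
    have hvx : G.Adj v x := hnbr p hzp v hv x hxC hpv hpx (fun h => hqx (h ▸ hqv))
    have hvy : G.Adj v y := hnbr q hzq v hv y hyC hqv hqy (fun h => hpy (h ▸ hpv))
    exact htent (hasInducedCopy_tent hpq hpv hqv hqy hvy hpx hvx hzp.symm hzq.symm hpy hqx
      (hzN v hv) (fun h => hnxy h.symm) (hzN y hyC) (hzN x hxC))
  · push Not at hcommon
    refine hhole (hasHole_of_insideMinus_reachable (B := C ∪ {p, q}) hpq (by simp) ?_ ?_)
    · rintro v (hv | rfl | rfl) h1 h2
      · exact hcommon v hv h1 h2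
      · exact G.irrefl h1
      · exact G.irrefl h2
    · have hCH := hCreach (G.insideMinus (C ∪ {p, q}) p q) fun u hu v hv huv =>
        ⟨huv, .inl hu, .inl hv, fun h => hpC (h.1 ▸ hu), fun h => hpC (h.2 ▸ hv)⟩
      have e1 : (G.insideMinus (C ∪ {p, q}) p q).Adj x p :=
        ⟨hpx.symm, .inl hxC, by simp, fun h => hpC (h.1 ▸ hxC), fun h => hqC (h.1 ▸ hxC)⟩
      have e2 : (G.insideMinus (C ∪ {p, q}) p q).Adj y q :=
        ⟨hqy.symm, .inl hyC, by simp, fun h => hpC (h.1 ▸ hyC), fun h => hqC (h.1 ▸ hyC)⟩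
      exact e1.symm.reachable.trans ((hCH x hxC).symm.trans ((hCH y hyC).trans e2.reachable))

theorem SimpleGraph.exists_adj_dist_eq {V : Type*} {G : SimpleGraph V} {z x : V} {n : ℕ}
    (h : G.dist z x = n + 1) : ∃ p, G.Adj p x ∧ G.dist z p = n := by
  obtain ⟨w, hw⟩ := exists_walk_of_dist_ne_zero (show G.dist z x ≠ 0 by omega)
  refine ⟨w.getVert n, ?_, w.dist_getVert hw (by omega)⟩
  have := w.adj_getVert_succ (i := n) (by omega)
  rwa [show n + 1 = w.length by omega, w.getVert_length] at this

/-- In a claw-, net- and hole-free graph, if the vertices at distance one and those at distance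
two from `z` form cliques, then so do the vertices at any other distance. -/
theorem adj_of_dist_eq {V : Type*} {G : SimpleGraph V}
    (hclaw : ¬ G.HasInducedCopy clawGraph) (hnet : ¬ G.HasInducedCopy netGraph)
    (hhole : ¬ G.HasHole) {z : V} (hone : ∀ a b, G.Adj z a → G.Adj z b → a ≠ b → G.Adj a b)
    (htwo : ∀ p q x y, G.Adj z p → G.Adj p x → x ≠ z → ¬ G.Adj z x →
        G.Adj z q → G.Adj q y → y ≠ z → ¬ G.Adj z y → x ≠ y → G.Adj x y) (n : ℕ) :
    ∀ x y, G.Reachable z x → G.Reachable z y → G.dist z x = n → G.dist z y = n → x ≠ y →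
      G.Adj x y := by
  have hfar : ∀ a b, G.dist z a + 1 < G.dist z b → ¬ G.Adj a b := by
    intro a b h hab
    have := hab.diff_dist_adj (u := z)
    omega
  have hlt : ∀ a b, G.dist z a < G.dist z b → a ≠ b := by
    rintro a b h rfl
    omega
  induction n using Nat.strong_induction_on with
  | _ n ih =>
  intro x y hx hy hdx hdy hxy
  match n, ih, hdx, hdy with
  | 0, _, hdx, hdy => exact (hxy ((hx.dist_eq_zero_iff.1 hdx).symm.trans
      (hy.dist_eq_zero_iff.1 hdy))).elim
  | 1, _, hdx, hdy =>
    exact hone x y (SimpleGraph.dist_eq_one_iff_adj.1 hdx) (SimpleGraph.dist_eq_one_iff_adj.1 hdy)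
      hxy
  | 2, _, hdx, hdy =>
    have key : ∀ u, G.dist z u = 2 → ∃ p, G.Adj z p ∧ G.Adj p u ∧ u ≠ z ∧ ¬ G.Adj z u := by
      intro u hu
      obtain ⟨p, hp, hzp⟩ := SimpleGraph.exists_adj_dist_eq hu
      refine ⟨p, SimpleGraph.dist_eq_one_iff_adj.1 hzp, hp, ?_, ?_⟩
      · rintro rfl
        simp at hu
      · exact hfar z u (by simp [hu])
    obtain ⟨p, h1, h2, h3, h4⟩ := key x hdx
    obtain ⟨q, h5, h6, h7, h8⟩ := key y hdy
    exact htwo p q x y h1 h2 h3 h4 h5 h6 h7 h8 hxy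
  | m + 3, ih, hdx, hdy =>
    by_contra hnxy
    have hr : ∀ a, 0 < G.dist z a → G.Reachable z a := fun a ha => .of_dist_ne_zero ha.ne'
    obtain ⟨p, hpx, hdp⟩ := SimpleGraph.exists_adj_dist_eq hdx
    obtain ⟨q, hqy, hdq⟩ := SimpleGraph.exists_adj_dist_eq hdy
    have hnocommon : ∀ u, G.dist z u = m + 2 → G.Adj u x → ¬ G.Adj u y := by
      intro u hu hux huy
      obtain ⟨t, htu, hdt⟩ := SimpleGraph.exists_adj_dist_eq hu
      exact hclaw (hasInducedCopy_claw htu.symm hux huy (hlt _ _ (by omega)) (hlt _ _ (by omega))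
        hxy (hfar _ _ (by omega)) (hfar _ _ (by omega)) hnxy)
    have hpy := hnocommon p hdp hpx
    have hqx : ¬ G.Adj q x := fun h => hnocommon q hdq h hqy
    have hne : p ≠ q := fun h => hpy (h ▸ hqy)
    have hpq : G.Adj p q := ih (m + 2) (by omega) p q (hr p (by omega)) (hr q (by omega)) hdp hdq
      hne
    obtain ⟨t, hdt, htp, htq⟩ : ∃ t, G.dist z t = m + 1 ∧ G.Adj t p ∧ G.Adj t q := by
      obtain ⟨t, htp, hdt⟩ := SimpleGraph.exists_adj_dist_eq hdp
      obtain ⟨u, huq, hdu⟩ := SimpleGraph.exists_adj_dist_eq hdq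
      by_cases htq : G.Adj t q
      · exact ⟨t, hdt, htp, htq⟩
      by_cases hup : G.Adj u p
      · exact ⟨u, hdu, hup, huq⟩
      have htu : t ≠ u := fun h => htq (h ▸ huq)
      exact (hhole (hasHole_of_square hpq huq.symm (ih (m + 1) (by omega) u t (hr u (by omega))
        (hr t (by omega)) hdu hdt htu.symm) htp (hlt u p (by omega)).symm
        (hlt t q (by omega)).symm (fun h => hup h.symm) (fun h => htq h.symm))).elim
    obtain ⟨s, hst, hds⟩ := SimpleGraph.exists_adj_dist_eq hdt
    exact hnet (hasInducedCopy_net hpq htp.symm htq.symm hpx hqy hst.symm hpy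
      (fun h => hfar s p (by omega) h.symm) hqx (fun h => hfar s q (by omega) h.symm)
      (hfar t x (by omega)) (hfar t y (by omega)) hnxy (fun h => hfar s x (by omega) h.symm)
      (fun h => hfar s y (by omega) h.symm))

theorem isUnitIntervalGraph_of_not_hasInducedCopy {V : Type*} [Fintype V] {G : SimpleGraph V}
    (hclaw : ¬ G.HasInducedCopy clawGraph) (htent : ¬ G.HasInducedCopy tentGraph)
    (hnet : ¬ G.HasInducedCopy netGraph) (hhole : ¬ G.HasHole) : G.IsUnitIntervalGraph := by
  choose Z hZr hZ1 hZ2 using exists_extreme_vertex hclaw htent hhole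
  let r : V → V := fun v => Z (G.connectedComponentMk v).out
  have hr : ∀ v, G.Reachable (r v) v := fun v =>
    (hZr _).symm.trans (SimpleGraph.ConnectedComponent.exact (Quot.out_eq _))
  have hradj : ∀ u v, G.Adj u v → r u = r v := fun u v h => by
    simp only [r, SimpleGraph.ConnectedComponent.sound h.reachable]
  let d : V → ℕ := fun v => G.dist (r v) v
  have hdadj : ∀ u v, G.Adj u v → d v = d u ∨ d v = d u + 1 ∨ d v + 1 = d u := by
    intro u v h
    have h1 := h.diff_dist_adj (u := r u)
    simp only [d, ← hradj u v h]
    omega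
  have hlevel : ∀ u v, r u = r v → d u = d v → u ≠ v → G.Adj u v := fun u v hruv hd hne =>
    adj_of_dist_eq hclaw hnet hhole (hZ1 _) (hZ2 _) (d v) u v
      (show G.Reachable (r v) u from hruv ▸ hr u) (hr v)
      (by simp only [← hd, d, ← hruv, r]) rfl hne
  let up : V → Set V := fun v => {w | G.Adj v w ∧ d w = d v + 1}
  let dn : V → Set V := fun v => {w | G.Adj v w ∧ d w + 1 = d v}
  let s : V → ℤ := fun v => (up v).ncard - (dn v).ncard
  have hexcl : ∀ u v, r u = r v → d u = d v → ∀ a ∈ up u, a ∉ up v → dn u ⊆ dn v := by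
    intro u v hruv hd a ha hav b hb
    by_contra hbv
    have hne : u ≠ v := by rintro rfl; exact hav ha
    have nav : ¬ G.Adj v a := fun h => hav ⟨h, ha.2.trans (by rw [hd])⟩
    have nbv : ¬ G.Adj v b := fun h => hbv ⟨h, hb.2.trans hd⟩
    have h1 := ha.2
    have h2 := hb.2
    refine hclaw (hasInducedCopy_claw (hlevel u v hruv hd hne) ha.1 hb.1 ?_ ?_ ?_ nav nbv ?_)
    · rintro rfl; omega
    · rintro rfl; omega
    · rintro rfl; omega
    · intro h
      have := hdadj a b h
      omega
  have hsquare : ∀ u v, r u = r v → d u = d v → ∀ a b, G.Adj u a → G.Adj v b → d a = d b →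
      d a ≠ d u → ¬ G.Adj v a → G.Adj u b := by
    intro u v hruv hd a b hua hvb hdab hdau hva
    by_contra hub
    have hne : u ≠ v := fun h => hva (h ▸ hua)
    have hab : a ≠ b := fun h => hub (h ▸ hua)
    refine hhole (hasHole_of_square hua (hlevel a b ?_ hdab hab) hvb.symm
      (hlevel v u hruv.symm hd.symm hne.symm) ?_ ?_ hub (fun h => hva h.symm))
    · rw [← hradj u a hua, hruv, hradj v b hvb]
    · rintro rfl; omega
    · rintro rfl; omega
  have hup : ∀ u v, r u = r v → d u = d v → ∀ a ∈ up u, a ∉ up v → s v < s u := by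
    intro u v hruv hd a ha hav
    have nav : ¬ G.Adj v a := fun h => hav ⟨h, ha.2.trans (by rw [hd])⟩
    have h1 : (up v).ncard < (up u).ncard := by
      refine Set.ncard_lt_ncard ⟨fun b hb => ?_, fun h => hav (h ha)⟩ (Set.toFinite _)
      have := ha.2
      have := hb.2
      exact ⟨hsquare u v hruv hd a b ha.1 hb.1 (by omega) (by omega) nav, by omega⟩
    have h2 := Set.ncard_le_ncard (hexcl u v hruv hd a ha hav) (Set.toFinite _)
    simp only [s]
    omega
  have hdn : ∀ u v, r u = r v → d u = d v → ∀ a ∈ dn u, a ∉ dn v → s u < s v := by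
    intro u v hruv hd a ha hav
    have nav : ¬ G.Adj v a := fun h => hav ⟨h, ha.2.trans hd⟩
    have h1 : (dn v).ncard < (dn u).ncard := by
      refine Set.ncard_lt_ncard ⟨fun b hb => ?_, fun h => hav (h ha)⟩ (Set.toFinite _)
      have := ha.2
      have := hb.2
      exact ⟨hsquare u v hruv hd a b ha.1 hb.1 (by omega) (by omega) nav, by omega⟩
    have h2 : up u ⊆ up v := fun b hb => by
      by_contra hbv
      exact hav (hexcl u v hruv hd b hb hbv ha)
    have h3 := Set.ncard_le_ncard h2 (Set.toFinite _)
    simp only [s]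
    omega
  let e := Fintype.equivFin V
  refine isUnitIntervalGraph_of_umbrella (fun v => toLex (e (r v), toLex (d v, s v))) ?_
  intro u v w huv hvw h1 h2 huw
  have hruw := hradj u w huw
  simp only [Prod.Lex.toLex_le_toLex] at h1 h2
  have hruv : r u = r v := by
    have : e (r u) ≤ e (r v) := by rcases h1 with h | h; exacts [h.le, h.1.le]
    have h' : e (r v) ≤ e (r w) := by rcases h2 with h | h; exacts [h.le, h.1.le]
    rw [← hruw] at h'
    exact e.injective (le_antisymm this h')
  have hrvw : r v = r w := hruv.symm.trans hruw
  simp only [hruv, hrvw, lt_irrefl, false_or, true_and] at h1 h2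
  have hd := hdadj u w huw
  rcases h1 with h1 | ⟨h1, h1s⟩
  · rcases h2 with h2 | ⟨h2, h2s⟩
    · omega
    · refine ⟨?_, hlevel v w hrvw h2 hvw⟩
      by_contra hnuv
      exact h2s.not_gt (hdn w v hrvw.symm h2.symm u ⟨huw.symm, by omega⟩
        fun h => hnuv h.1.symm)
  · refine ⟨hlevel u v hruv h1 huv, ?_⟩
    rcases h2 with h2 | ⟨h2, -⟩
    · by_contra hnvw
      exact h1s.not_gt (hup u v hruv h1 w ⟨huw, by omega⟩ fun h => hnvw h.1)
    · exact hlevel v w hrvw h2 hvw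

/-- A finite graph is a unit interval graph iff it contains no induced
claw, tent `S_3`, net, or hole. -/
theorem stmt16 {V : Type*} [Fintype V] (G : SimpleGraph V) :
    G.IsUnitIntervalGraph ↔
      (¬ G.HasInducedCopy clawGraph ∧ ¬ G.HasInducedCopy tentGraph ∧
       ¬ G.HasInducedCopy netGraph ∧ ¬ G.HasHole) := by
  exact ⟨fun h => ⟨h.not_claw, h.not_tent, h.not_net, h.not_hole⟩,
    fun h => isUnitIntervalGraph_of_not_hasInducedCopy h.1 h.2.1 h.2.2.1 h.2.2.2⟩
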